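/- Every k-extendible graph is (k+1)-connected. That is, if G is a k-extendible graph with k ≥ 1, then G has more than k+1 vertices and the deletion of any set of at most k vertices leaves a connected graph. -/

import Mathlib

/-- A graph `G` is `k`-extendible if it has at least `2k+2` vertices, is connected,
has a perfect matching, and every matching of size `k` extends to a perfect matching. -/
def SimpleGraph.IsKExtendible {V : Type*} (G : SimpleGraph V) (k : ℕ) : Prop :=
  2 * k + 2 ≤ Nat.card V ∧ G.Connected ∧
    (∃ P : G.Subgraph, P.IsPerfectMatching) ∧
    ∀ M : G.Subgraph, M.IsMatching → M.edgeSet.ncard = k →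
      ∃ P : G.Subgraph, P.IsPerfectMatching ∧ M ≤ P

namespace KExt

open Finset

variable {V : Type*} [Fintype V] [DecidableEq V]

/-- matchings as involutions -/
def IsM (G : SimpleGraph V) (m : V → V) : Prop :=
  (∀ x, m (m x) = x) ∧ ∀ x, m x ≠ x → G.Adj x (m x)

def sp (m : V → V) : Finset V := univ.filter (fun x => m x ≠ x)

lemma mem_sp (m : V → V) (x : V) : x ∈ sp m ↔ m x ≠ x := by simp [sp]

lemma even_card (A : Finset V) (f : V → V) (h1 : ∀ x ∈ A, f (f x) = x) (h2 : ∀ x ∈ A, f x ≠ x)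
    (h3 : ∀ x ∈ A, f x ∈ A) : Even A.card := by
  have h : ∑ x ∈ A, (1 : ZMod 2) = 0 := by
    refine Finset.sum_involution (fun a _ => f a) ?_ ?_ ?_ ?_
    · intros; decide
    · intro a ha _; exact h2 a ha
    · intro a ha; exact h3 a ha
    · intro a ha; exact h1 a ha
  rw [Finset.sum_const, nsmul_eq_mul, mul_one] at h
  exact (ZMod.natCast_eq_zero_iff_even).1 h

/-- every matching with at most `k` edges in `W` extends to a perfect matching of `W` -/
def Ext (G : SimpleGraph V) (W : Finset V) (k : ℕ) : Prop :=
  ∀ m, IsM G m → sp m ⊆ W → (sp m).card ≤ 2 * k →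
    ∃ p, IsM G p ∧ sp p = W ∧ ∀ x, m x ≠ x → p x = m x

def NoE (G : SimpleGraph V) (A B : Finset V) : Prop := ∀ a ∈ A, ∀ b ∈ B, ¬ G.Adj a b

lemma NoE.symm {G : SimpleGraph V} {A B : Finset V} (h : NoE G A B) : NoE G B A :=
  fun a ha b hb hab => h b hb a ha hab.symm

def Conn (G : SimpleGraph V) (W : Finset V) : Prop :=
  ∀ A B : Finset V, A.Nonempty → B.Nonempty → Disjoint A B → A ∪ B = W → ¬ NoE G A B

def sw (u v : V) (m : V → V) : V → V := fun x => if x = u then v else if x = v then u else m x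

lemma isM_id (G : SimpleGraph V) : IsM G id := ⟨fun _ => rfl, fun x h => absurd rfl h⟩

lemma isM_sw {G : SimpleGraph V} {m : V → V} (hm : IsM G m) {u v : V} (h : G.Adj u v)
    (hu : m u = u) (hv : m v = v) : IsM G (sw u v m) := by
  have hne := h.ne
  have h' := h.symm
  obtain ⟨h1, h2⟩ := hm
  constructor
  · intro x; unfold sw; grind
  · intro x; unfold sw; grind

lemma sp_sw {m : V → V} {u v : V} (hne : u ≠ v) : sp (sw u v m) = insert u (insert v (sp m)) := by
  ext x; simp only [mem_sp, mem_insert, sw]; grind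

lemma sp_id : sp (id : V → V) = ∅ := by ext; simp [mem_sp]

lemma parity {G : SimpleGraph V} {A B S : Finset V} {k : ℕ} (hE : Ext G (A ∪ B ∪ S) k)
    (hN : NoE G A B) {m : V → V} (hm : IsM G m) (hs : sp m ⊆ A ∪ B ∪ S)
    (hS : S ⊆ sp m) (hc : (sp m).card ≤ 2 * k) : Even (A \ sp m).card := by
  obtain ⟨p, hp, hpW, hpm⟩ := hE m hm hs hc
  have hx : ∀ x ∈ A \ sp m, p x ≠ x := by
    intro x hx
    rw [← mem_sp, hpW]; simp at hx; simp [hx.1]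
  refine even_card _ p (fun x _ => hp.1 x) hx ?_
  intro x hxA
  have hpx := hx x hxA
  have hadj := hp.2 x hpx
  have h1 : p x ∉ sp m := by
    intro h
    have h' := (mem_sp _ _).1 h
    have := hpm _ h'
    rw [hp.1] at this
    have h3 : m x = p x := (congrArg m this).trans (hm.1 _)
    exact (mem_sdiff.1 hxA).2 ((mem_sp _ _).2 (by rw [h3]; exact hpx))
  have h2 : p x ∈ A ∪ B ∪ S := by
    rw [← hpW, mem_sp, hp.1]; exact hpx.symm
  have h3 := hN x (mem_sdiff.1 hxA).1 (p x)
  have h4 := @hS (p x)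
  simp only [mem_union] at h2
  simp only [mem_sdiff]
  tauto

lemma ext_del {G : SimpleGraph V} {W : Finset V} {k : ℕ} (hE : Ext G W (k + 1)) {u v : V}
    (hu : u ∈ W) (hv : v ∈ W) (h : G.Adj u v) : Ext G (W \ {u, v}) k := by
  intro m hm hs hc
  have hmu : m u = u := by
    by_contra h; have := hs ((mem_sp _ _).2 h); simp at this
  have hmv : m v = v := by
    by_contra h; have := hs ((mem_sp _ _).2 h); simp at this
  have hne := h.ne
  obtain ⟨p, hp, hpW, hpm⟩ := hE (sw u v m) (isM_sw hm h hmu hmv)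
    (by rw [sp_sw hne]; intro x hx; have := @hs x; simp at hx this; grind)
    (by rw [sp_sw hne]
        have := card_insert_le u (insert v (sp m))
        have := card_insert_le v (sp m)
        omega)
  have hpu : p u = v := by rw [hpm u] <;> simp [sw, hne.symm]
  have hpv : p v = u := by rw [← hpu, hp.1]
  refine ⟨fun x => if x = u ∨ x = v then x else p x, ⟨?_, ?_⟩, ?_, ?_⟩
  · have := hp.1; intro x; grind
  · have := hp.2; intro x; grind
  · ext x
    have := mem_sp p x
    rw [hpW] at this
    simp only [mem_sp, mem_sdiff, mem_insert, mem_singleton]; grind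
  · intro x hx
    have := hpm x
    simp only [sw] at this
    grind

lemma Ext.mono {G : SimpleGraph V} {W : Finset V} {k l : ℕ} (hE : Ext G W k) (h : l ≤ k) :
    Ext G W l := fun m hm hs hc => hE m hm hs (by omega)

def Good (G : SimpleGraph V) (k : ℕ) : Prop :=
  ∀ A B S : Finset V, A.Nonempty → B.Nonempty → Disjoint A B → Disjoint A S → Disjoint B S →
    S.card ≤ k → 2 * k + 2 ≤ (A ∪ B ∪ S).card → Ext G (A ∪ B ∪ S) k → Conn G (A ∪ B ∪ S) →
    ¬ NoE G A B

lemma exists_nbr {G : SimpleGraph V} {A B S : Finset V} (hA : A.Nonempty) (hB : B.Nonempty)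
    (hAB : Disjoint A B) (hAS : Disjoint A S) (hC : Conn G (A ∪ B ∪ S)) (hN : NoE G A B) :
    ∃ u ∈ S, ∃ v ∈ A, G.Adj u v := by
  have := hC A (B ∪ S) hA (hB.mono subset_union_left) (by simp [hAB, hAS])
    (by rw [union_assoc])
  unfold NoE at this
  push Not at this
  obtain ⟨a, ha, b, hb, hab⟩ := this
  rcases mem_union.1 hb with hb | hb
  · exact absurd hab (hN a ha b hb)
  · exact ⟨b, hb, a, ha, hab.symm⟩

lemma good_one (G : SimpleGraph V) : Good G 1 := by
  intro A B S hA hB hAB hAS hBS hS hc hE hC hN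
  obtain ⟨u, hu, v, hv, huv⟩ := exists_nbr hA hB hAB hAS hC hN
  have hC' : Conn G (B ∪ A ∪ S) := by rwa [union_comm B A]
  obtain ⟨u', hu', w, hw, huw⟩ := exists_nbr hB hA hAB.symm hBS hC' hN.symm
  have hS1 : S = {u} := by
    apply eq_singleton_iff_unique_mem.2 ⟨hu, fun x hx => card_le_one.1 hS x hx u hu⟩
  subst hS1
  obtain rfl : u' = u := by simpa using hu'
  have hs1 : sp (sw u' v id) = {u', v} := by rw [sp_sw huv.ne, sp_id]; rfl
  have hs2 : sp (sw u' w id) = {u', w} := by rw [sp_sw huw.ne, sp_id]; rfl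
  have h1 := parity hE hN (isM_sw (isM_id G) huv rfl rfl) (by rw [hs1]; grind)
    (by rw [hs1]; grind) (by rw [hs1]; exact card_le_two)
  have h2 := parity hE hN (isM_sw (isM_id G) huw rfl rfl) (by rw [hs2]; grind)
    (by rw [hs2]; grind) (by rw [hs2]; exact card_le_two)
  rw [Finset.disjoint_left] at hAB hAS
  have e1 : A \ sp (sw u' v id) = A.erase v := by rw [hs1]; ext x; grind
  have e2 : A \ sp (sw u' w id) = A := by rw [hs2]; ext x; grind
  rw [e1, card_erase_of_mem hv] at h1
  rw [e2] at h2
  have := card_pos.2 hA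
  rw [Nat.even_iff] at h1 h2
  omega

lemma conn_del {G : SimpleGraph V} {k : ℕ} (hk : 1 ≤ k) (ih : Good G 1) {W : Finset V}
    (hc : 2 * (k + 1) + 2 ≤ W.card) (hE : Ext G W (k + 1)) (hC : Conn G W) {u v : V}
    (hu : u ∈ W) (hv : v ∈ W) (h : G.Adj u v) : Conn G (W \ {u, v}) := by
  intro C D hCn hDn hCD hW hN
  have hne := h.ne
  have huW : u ∉ C ∪ D := by rw [hW]; simp
  have hvW : v ∉ C ∪ D := by rw [hW]; simp
  have hWeq : C ∪ D ∪ {u, v} = W := by rw [hW]; ext x; grind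
  simp only [mem_union, not_or] at huW hvW
  have key : ∀ x y : V, ({x, y} : Finset V) = {u, v} → x ≠ y → ∀ C D : Finset V, C.Nonempty →
      D.Nonempty → Disjoint C D → x ∉ C → x ∉ D → y ∉ C → y ∉ D → C ∪ D ∪ {u, v} = W → NoE G C D →
      ∃ d ∈ D, G.Adj x d := by
    intro x y hxy hne C D hCn hDn hCD hxC hxD hyC hyD hWeq hN
    have hW' : insert x C ∪ D ∪ {y} = W := by rw [← hWeq, ← hxy]; ext z; grind
    have := ih (insert x C) D {y} (by simp) hDn (by simp [hxD, hCD]) (by simp [hyC, hne.symm])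
      (by simp [hyD]) (by simp) (by rw [hW']; omega) (by rw [hW']; exact hE.mono (by omega))
      (by rw [hW']; exact hC)
    unfold NoE at this
    push Not at this
    obtain ⟨a, ha, b, hb, hab⟩ := this
    rcases mem_insert.1 ha with rfl | ha
    · exact ⟨b, hb, hab⟩
    · exact absurd hab (hN a ha b hb)
  obtain ⟨d, hd, hvd⟩ := key v u (by ext; grind) hne.symm C D hCn hDn hCD hvW.1 hvW.2 huW.1 huW.2
    hWeq hN
  obtain ⟨c, hcC, huc⟩ := key u v rfl hne D C hDn hCn hCD.symm huW.2 huW.1 hvW.2 hvW.1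
    (by rw [← hWeq]; ext; grind) hN.symm
  rw [← hWeq] at hE
  rw [Finset.disjoint_left] at hCD
  clear key ih hW hC
  have hud : u ≠ d := fun e => huW.2 (e ▸ hd)
  have hcv : c ≠ v := fun e => hvW.1 (e ▸ hcC)
  have hcd : c ≠ d := fun e => hCD hcC (e ▸ hd)
  have hs1 : sp (sw u v id) = {u, v} := by rw [sp_sw hne, sp_id]; rfl
  have hs2 : sp (sw u c (sw v d id)) = {u, c, v, d} := by
    rw [sp_sw huc.ne, sp_sw hvd.ne, sp_id]; rfl
  have h1 := parity hE hN (isM_sw (isM_id G) h rfl rfl) (by rw [hs1]; grind)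
    (by rw [hs1]) (by rw [hs1]; have := card_le_two (a := u) (b := v); omega)
  have h2 := parity hE hN (isM_sw (isM_sw (isM_id G) hvd rfl rfl) huc
      (by simp [sw, hne, hud]) (by simp [sw, hcv, hcd])) (by rw [hs2]; grind)
    (by rw [hs2]; grind) (by rw [hs2]; have := card_le_four (a := u) (b := c) (c := v) (d := d); omega)
  have e1 : C \ sp (sw u v id) = C := by rw [hs1]; ext x; grind
  have e2 : C \ sp (sw u c (sw v d id)) = C.erase c := by rw [hs2]; ext x; grind
  rw [e2, card_erase_of_mem hcC] at h2
  rw [e1] at h1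
  have := card_pos.2 hCn
  rw [Nat.even_iff] at h1 h2
  omega

lemma good_step (G : SimpleGraph V) {k : ℕ} (hk : 1 ≤ k) (ih : Good G k) : Good G (k + 1) := by
  have key : ∀ A B S : Finset V, A.Nonempty → B.Nonempty → Disjoint A B → Disjoint A S →
      Disjoint B S → S.card ≤ k + 1 → 2 * (k + 1) + 2 ≤ (A ∪ B ∪ S).card →
      Ext G (A ∪ B ∪ S) (k + 1) → Conn G (A ∪ B ∪ S) → NoE G A B → A.card ≤ 1 := by
    intro A B S hA hB hAB hAS hBS hS hc hE hC hN
    obtain ⟨u, hu, v, hv, huv⟩ := exists_nbr hA hB hAB hAS hC hN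
    by_contra hA1
    have huW : u ∈ A ∪ B ∪ S := by simp [hu]
    have hvW : v ∈ A ∪ B ∪ S := by simp [hv]
    have hE' := ext_del hE huW hvW huv
    have hC' := conn_del hk (good_one G) hc hE hC huW hvW huv
    have hcard : ((A ∪ B ∪ S) \ {u, v}).card = (A ∪ B ∪ S).card - 2 := by
      rw [card_sdiff_of_subset (by grind), card_pair huv.ne]
    have hWe : A.erase v ∪ B ∪ S.erase u = (A ∪ B ∪ S) \ {u, v} := by
      rw [Finset.disjoint_left] at hAB hAS hBS
      ext x; grind
    refine ih (A.erase v) B (S.erase u) ?_ hB (hAB.mono_left (erase_subset _ _))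
      (hAS.mono (erase_subset _ _) (erase_subset _ _)) (hBS.mono_right (erase_subset _ _))
      ?_ ?_ ?_ ?_ ?_
    · rw [← card_pos, card_erase_of_mem hv]; omega
    · rw [card_erase_of_mem hu]; omega
    · rw [hWe]; omega
    · rwa [hWe]
    · rwa [hWe]
    · exact fun a ha => hN a (mem_of_mem_erase ha)
  intro A B S hA hB hAB hAS hBS hS hc hE hC hN
  have h1 := key A B S hA hB hAB hAS hBS hS hc hE hC hN
  have hcomm : B ∪ A ∪ S = A ∪ B ∪ S := by rw [union_comm B A]
  have h2 := key B A S hB hA hAB.symm hBS hAS hS (by rwa [hcomm]) (by rwa [hcomm])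
    (by rwa [hcomm]) hN.symm
  have := card_union_le (A ∪ B) S
  have := card_union_le A B
  omega

lemma good (G : SimpleGraph V) {k : ℕ} (hk : 1 ≤ k) : Good G k := by
  induction k, hk using Nat.le_induction with
  | base => exact good_one G
  | succ n hn ih => exact good_step G hn ih

/-- exact version -/
def ExtE (G : SimpleGraph V) (k : ℕ) : Prop :=
  ∀ m, IsM G m → (sp m).card = 2 * k →
    ∃ p, IsM G p ∧ sp p = univ ∧ ∀ x, m x ≠ x → p x = m x

lemma extE_step {G : SimpleGraph V} {k : ℕ} (hc : 2 * (k + 1) + 2 ≤ Fintype.card V)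
    {P : V → V} (hP : IsM G P) (hPs : sp P = univ) (hE : ExtE G (k + 1)) : ExtE G k := by
  have hPne : ∀ x, P x ≠ x := fun x => by rw [← mem_sp, hPs]; simp
  suffices H : ∀ n : ℕ, ∀ m, IsM G m → (sp m).card = 2 * k →
      (univ.filter (fun x => m x ≠ P x)).card = n →
      ∃ p, IsM G p ∧ sp p = univ ∧ ∀ x, m x ≠ x → p x = m x from
    fun m hm hs => H _ m hm hs rfl
  intro n
  induction n using Nat.strong_induction_on with
  | _ n ih =>
  intro m hm hs hn
  by_contra hcon
  have hind : ∀ x y, m x = x → m y = y → ¬ G.Adj x y := by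
    intro x y hx hy hxy
    apply hcon
    obtain ⟨p, hp, hps, hpm⟩ := hE (sw x y m) (isM_sw hm hxy hx hy) (by
      rw [sp_sw hxy.ne, card_insert_of_notMem, card_insert_of_notMem]
      · omega
      · simp [mem_sp, hy]
      · simp [mem_sp, hx, hxy.ne])
    refine ⟨p, hp, hps, fun z hz => ?_⟩
    have := hpm z
    simp only [sw] at this
    grind
  have hUc : 4 ≤ (univ \ sp m).card := by
    rw [card_sdiff_of_subset (subset_univ _), card_univ]; omega
  obtain ⟨u, hu⟩ : (univ \ sp m).Nonempty := by rw [← card_pos]; omega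
  have hmu : m u = u := by simpa [mem_sp] using hu
  obtain ⟨a, ha⟩ : ∃ a, a = P u := ⟨_, rfl⟩
  have hua : G.Adj u a := ha ▸ hP.2 u (hPne u)
  have hPa : P a = u := by rw [ha, hP.1]
  have hma : m a ≠ a := fun h => hind u a hmu h hua
  obtain ⟨b, hb⟩ : ∃ b, b = m a := ⟨_, rfl⟩
  have hmb : m b = a := by rw [hb, hm.1]
  have hab : G.Adj a b := hb ▸ hm.2 a hma
  have hune := hua.ne
  have habne := hab.ne
  have hub : u ≠ b := by rintro rfl; exact hune (hmu.symm.trans hmb)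
  obtain ⟨m', hm'⟩ : ∃ m' : V → V, m' = fun x => if x = u then a else if x = a then u else
    if x = b then b else m x := ⟨_, rfl⟩
  have hM' : IsM G m' := by
    have := hm.1
    have := hm.2
    have := hua.symm
    rw [hm']
    constructor
    · intro x; grind
    · intro x; grind
  have hsp : sp m' = insert u ((sp m).erase b) := by
    ext x; simp only [mem_sp, mem_insert, mem_erase, hm']; grind
  have hcard : (sp m').card = 2 * k := by
    rw [hsp, card_insert_of_notMem (by simp [mem_sp, hmu]), card_erase_of_mem
      (by rw [mem_sp, hmb]; exact habne)]
    have : 0 < (sp m).card := card_pos.2 ⟨a, (mem_sp _ _).2 hma⟩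
    omega
  obtain ⟨p, hp, hps, hpm⟩ := ih _ (by
    rw [← hn]
    apply card_lt_card
    rw [Finset.ssubset_iff_of_subset]
    · refine ⟨u, ?_, ?_⟩
      · simp [hmu, ← ha, hune]
      · simp [hm', ← ha]
    · intro x
      simp only [mem_filter, mem_univ, true_and, hm']
      have := hP.1 b
      grind) m' hM' hcard rfl
  have hpne : ∀ x, p x ≠ x := fun x => by rw [← mem_sp, hps]; simp
  obtain ⟨x, hx⟩ : ((univ \ sp m) \ {u, p b}).Nonempty := by
    rw [← card_pos]
    have := le_card_sdiff {u, p b} (univ \ sp m)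
    have := card_le_two (a := u) (b := p b)
    omega
  simp only [mem_sdiff, mem_univ, true_and, mem_sp, not_not, mem_insert, mem_singleton,
    not_or] at hx
  obtain ⟨hmx, hxu, hxb⟩ := hx
  have hadj := hp.2 x (hpne x)
  have hpx := hpne x
  have hxa : x ≠ a := by rintro rfl; exact hma hmx
  have hxb' : x ≠ b := by rintro rfl; exact habne (hmb.symm.trans hmx)
  have hm'x : m' x = x := by simp [hm', hxu, hxa, hxb', hmx]
  have h1 : p x ≠ b := by intro h; apply hxb; rw [← h, hp.1]
  have h2 : m' (p x) = p x := by
    by_contra h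
    have h3 := hpm _ h
    rw [hp.1] at h3
    apply hpx
    rw [← hM'.1 (p x), ← h3, hm'x]
  have h4 : m (p x) = p x := by
    simp only [hm'] at h2; grind
  exact hind x (p x) hmx h4 hadj

lemma extE_all {G : SimpleGraph V} {k : ℕ} (hc : 2 * k + 2 ≤ Fintype.card V)
    {P : V → V} (hP : IsM G P) (hPs : sp P = univ) (hE : ExtE G k) : ∀ j ≤ k, ExtE G j := by
  induction k with
  | zero => intro j hj; obtain rfl : j = 0 := by omega
            exact hE
  | succ k ih =>
    intro j hj
    rcases Nat.lt_or_ge j (k + 1) with h | h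
    · exact ih (by omega) (extE_step hc hP hPs hE) j (by omega)
    · obtain rfl : j = k + 1 := by omega
      exact hE

lemma ext_of_extE {G : SimpleGraph V} {k : ℕ} (hc : 2 * k + 2 ≤ Fintype.card V)
    {P : V → V} (hP : IsM G P) (hPs : sp P = univ) (hE : ExtE G k) : Ext G univ k := by
  intro m hm _ hs
  have : Even (sp m).card := even_card _ m (fun x _ => hm.1 x) (fun x hx => (mem_sp _ _).1 hx)
    (fun x hx => by rw [mem_sp] at *; rw [hm.1]; exact hx.symm)
  obtain ⟨j, hj⟩ := this
  exact extE_all hc hP hPs hE j (by omega) m hm (by omega)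

lemma perf_to_fun {G : SimpleGraph V} {P : G.Subgraph} (hP : P.IsPerfectMatching) :
    ∃ p, IsM G p ∧ sp p = univ ∧ ∀ x y, P.Adj x y → p x = y := by
  rw [SimpleGraph.Subgraph.isPerfectMatching_iff] at hP
  choose p hp hu using hP
  refine ⟨p, ⟨fun x => ?_, fun x _ => (hp x).adj_sub⟩, ?_, fun x y h => (hu x y h).symm⟩
  · exact (hu _ _ (hp x).symm).symm
  · ext x; simp only [mem_sp, mem_univ, iff_true]; exact (hp x).adj_sub.ne'

def toSub (G : SimpleGraph V) (m : V → V) (hm : IsM G m) : G.Subgraph where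
  verts := {x | m x ≠ x}
  Adj x y := m x = y ∧ m x ≠ x
  adj_sub := by rintro x y ⟨rfl, h⟩; exact hm.2 x h
  edge_vert := by rintro x y ⟨rfl, h⟩; exact h
  symm := by
    constructor
    rintro x y ⟨rfl, h⟩; exact ⟨hm.1 x, by rw [hm.1]; exact h.symm⟩

lemma toSub_card (G : SimpleGraph V) (m : V → V) (hm : IsM G m) :
    (sp m).card = 2 * (toSub G m hm).edgeSet.ncard := by
  classical
  have hmaps : ∀ x ∈ sp m, s(x, m x) ∈ (toSub G m hm).edgeSet.toFinset := by
    intro x hx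
    rw [Set.mem_toFinset, SimpleGraph.Subgraph.mem_edgeSet]
    exact ⟨rfl, (mem_sp _ _).1 hx⟩
  rw [Set.ncard_eq_toFinset_card', card_eq_sum_card_fiberwise hmaps, sum_const_nat (m := 2),
    mul_comm]
  intro e he
  rw [Set.mem_toFinset] at he
  induction e with
  | _ x y =>
  rw [SimpleGraph.Subgraph.mem_edgeSet] at he
  obtain ⟨rfl, h⟩ := he
  have : {a ∈ sp m | s(a, m a) = s(x, m x)} = {x, m x} := by
    have := hm.1
    ext a
    simp only [mem_filter, mem_sp, mem_insert, mem_singleton, Sym2.eq_iff]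
    grind
  rw [this, card_pair h.symm]

lemma extE_of {G : SimpleGraph V} {k : ℕ} (h : G.IsKExtendible k) : ExtE G k := by
  intro m hm hs
  obtain ⟨P, hP, hle⟩ := h.2.2.2 (toSub G m hm) (by
    intro x hx
    exact ⟨m x, ⟨rfl, hx⟩, fun y hy => hy.1.symm⟩) (by
    have := toSub_card G m hm; omega)
  obtain ⟨p, hp, hps, hpa⟩ := perf_to_fun hP
  exact ⟨p, hp, hps, fun x hx => hpa _ _ (hle.2 ⟨rfl, hx⟩)⟩

lemma conn_univ {G : SimpleGraph V} (h : G.Connected) : Conn G univ := by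
  intro A B ⟨a, ha⟩ ⟨b, hb⟩ hAB hU hN
  have : ∀ x y, G.Reachable x y → x ∈ A → y ∈ A := by
    rintro x y ⟨w⟩
    induction w with
    | nil => exact id
    | cons hadj _ ih =>
      intro hx
      apply ih
      rename_i u v w _
      have hv : v ∈ A ∪ B := by rw [hU]; simp
      rcases mem_union.1 hv with h | h
      · exact h
      · exact absurd hadj (hN _ hx _ h)
  exact Finset.disjoint_left.1 hAB (this a b (h.preconnected a b) ha) hb

end KExt

/-- Every `k`-extendible graph (`k ≥ 1`) is `(k+1)`-connected: it has more than
`k+1` vertices and deleting any set of at most `k` vertices leaves it connected. -/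
theorem kExtendible_kPlusOneConnected {V : Type*} [Fintype V]
    (G : SimpleGraph V) (k : ℕ) (hk : 1 ≤ k) (h : G.IsKExtendible k) :
    k + 1 < Fintype.card V ∧
      ∀ S : Set V, S.ncard ≤ k → (G.induce (Sᶜ : Set V)).Connected := by
  classical
  have hc : 2 * k + 2 ≤ Fintype.card V := by rw [← Nat.card_eq_fintype_card]; exact h.1
  refine ⟨by omega, fun S hS => ?_⟩
  obtain ⟨P, hP⟩ := h.2.2.1
  obtain ⟨p, hp, hps, -⟩ := KExt.perf_to_fun hP
  have hE := KExt.ext_of_extE hc hp hps (KExt.extE_of h)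
  have hC := KExt.conn_univ h.2.1
  have hS' : S.toFinset.card ≤ k := by rwa [← Set.ncard_eq_toFinset_card']
  rw [SimpleGraph.connected_iff]
  constructor
  · intro a b
    by_contra hab
    let A : Finset V := Finset.univ.filter
      (fun x => ∃ hx : x ∈ Sᶜ, (G.induce (Sᶜ : Set V)).Reachable a ⟨x, hx⟩)
    let B : Finset V := Finset.univ.filter
      (fun x => ∃ hx : x ∈ Sᶜ, ¬ (G.induce (Sᶜ : Set V)).Reachable a ⟨x, hx⟩)
    have hU : A ∪ B ∪ S.toFinset = Finset.univ := by
      ext x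
      by_cases hx : x ∈ S
      · simp [hx]
      · by_cases hr : (G.induce (Sᶜ : Set V)).Reachable a ⟨x, hx⟩
        · simp [A, B, hx, hr]
        · simp [A, B, hx, hr]
    refine KExt.good G hk A B S.toFinset ⟨a, ?_⟩ ⟨b, ?_⟩ ?_ ?_ ?_ hS' ?_ ?_ ?_ ?_
    · simp only [A, Finset.mem_filter, Finset.mem_univ, true_and]
      exact ⟨a.2, SimpleGraph.Reachable.refl _⟩
    · simp only [B, Finset.mem_filter, Finset.mem_univ, true_and]
      exact ⟨b.2, hab⟩
    · rw [Finset.disjoint_left]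
      intro x hx hx'
      simp only [A, B, Finset.mem_filter, Finset.mem_univ, true_and] at hx hx'
      exact hx'.2 hx.2
    · rw [Finset.disjoint_left]
      intro x hx hx'
      simp only [A, Finset.mem_filter, Finset.mem_univ, true_and] at hx
      exact hx.1 (by simpa using hx')
    · rw [Finset.disjoint_left]
      intro x hx hx'
      simp only [B, Finset.mem_filter, Finset.mem_univ, true_and] at hx
      exact hx.1 (by simpa using hx')
    · rw [hU, Finset.card_univ]; exact hc
    · rw [hU]; exact hE
    · rw [hU]; exact hC
    · intro x hx y hy hxy
      simp only [A, B, Finset.mem_filter, Finset.mem_univ, true_and] at hx hy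
      obtain ⟨hx, hrx⟩ := hx
      obtain ⟨hy, hry⟩ := hy
      apply hry
      refine hrx.trans (SimpleGraph.Adj.reachable ?_)
      simpa using hxy
  · have hSU : S.toFinset ≠ Finset.univ := by
      intro h
      rw [h, Finset.card_univ] at hS'
      omega
    obtain ⟨x, hx⟩ : ∃ x, x ∉ S := by
      by_contra hcon
      push Not at hcon
      exact hSU (by ext x; simp [hcon x])
    exact ⟨⟨x, hx⟩⟩
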